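/- Let n ≥ 1, let m be an integer with m + n ≥ 0, and let 1 ≤ i ≤ n. Then the following identity holds in F: Σ_{l=1}^{n} (−1)^{i+l} · c_l · e_{i−l}(u X_{n−i+2}, v X_{n−i+2}^{−1}, …, u X_n, v X_n^{−1}) · [ h_{m+l−1}(u X_1, v X_1^{−1}, …, u X_n, v X_n^{−1}) + (u v)^{l−1} h_{m−l+1}(u X_1, v X_1^{−1}, …, u X_n, v X_n^{−1}) ] = h_{m+i−1}(u X_1, v X_1^{−1}, …, u X_{n−i+1}, v X_{n−i+1}^{−1}), where c_1 = 1/2 and c_l = 1 for l ≥ 2, and where the elementary symmetric polynomial e_{i−l} is evaluated at the 2(i−1) quantities u X_{n−i+2}, v X_{n−i+2}^{−1}, u X_{n−i+3}, v X_{n−i+3}^{−1}, …, u X_n, v X_n^{−1}. -/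

import Mathlib

noncomputable section

/-- Complete homogeneous symmetric polynomial of degree `m` evaluated at the list `l`. -/
def hpow {R : Type*} [CommSemiring R] : ℕ → List R → R
  | 0, _ => 1
  | _ + 1, [] => 0
  | m + 1, x :: xs => hpow (m + 1) xs + x * hpow m (x :: xs)
  termination_by m l => m + l.length

/-- `h_m` with integer degree: zero for negative degrees. -/
def hz {R : Type*} [CommSemiring R] (m : ℤ) (l : List R) : R :=
  if m < 0 then 0 else hpow m.toNat l

/-- Elementary symmetric polynomial of degree `m` evaluated at the list `l`;
zero for `m` larger than the length of `l`. -/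
def epow {R : Type*} [CommSemiring R] : ℕ → List R → R
  | 0, _ => 1
  | _ + 1, [] => 0
  | m + 1, x :: xs => epow (m + 1) xs + x * epow m xs

/-- `e_m` with integer degree: zero for negative degrees. -/
def ez {R : Type*} [CommSemiring R] (m : ℤ) (l : List R) : R :=
  if m < 0 then 0 else epow m.toNat l

/-- The field `F = ℚ(u, v, w, X_1, …, X_n)` of rational functions. -/
abbrev Fld (n : ℕ) : Type := FractionRing (MvPolynomial (Fin n ⊕ Fin 3) ℚ)

/-- The indeterminate `u`. -/
def uu (n : ℕ) : Fld n :=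
  algebraMap (MvPolynomial (Fin n ⊕ Fin 3) ℚ) (Fld n) (MvPolynomial.X (Sum.inr 0))

/-- The indeterminate `v`. -/
def vv (n : ℕ) : Fld n :=
  algebraMap (MvPolynomial (Fin n ⊕ Fin 3) ℚ) (Fld n) (MvPolynomial.X (Sum.inr 1))

/-- The indeterminate `w`. -/
def wP (n : ℕ) : Fld n :=
  algebraMap (MvPolynomial (Fin n ⊕ Fin 3) ℚ) (Fld n) (MvPolynomial.X (Sum.inr 2))

/-- The indeterminate `X_i` (here `i : Fin n` corresponds to `X_{i+1}`). -/
def XP {n : ℕ} (i : Fin n) : Fld n :=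
  algebraMap (MvPolynomial (Fin n ⊕ Fin 3) ℚ) (Fld n) (MvPolynomial.X (Sum.inl i))

/-- The `2n` quantities `(u X_1, …, u X_n, v X_1^{−1}, …, v X_n^{−1})`. -/
def bigArgs (n : ℕ) : List (Fld n) :=
  ((List.finRange n).map fun i => uu n * XP i) ++ ((List.finRange n).map fun i => vv n * (XP i)⁻¹)

/-- `h_m(u X_1, …, u X_n, v X_1^{−1}, …, v X_n^{−1})`. -/
def Hn (n : ℕ) (m : ℤ) : Fld n := hz m (bigArgs n)

/-- The `2n` quantities `(u X_1, v X_1^{−1}, u X_2, v X_2^{−1}, …, u X_n, v X_n^{−1})`. -/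
def interArgs (n : ℕ) : List (Fld n) :=
  (List.finRange n).flatMap fun d => [uu n * XP d, vv n * (XP d)⁻¹]

/-- The `2(i−1)` quantities `(u X_{n−i+2}, v X_{n−i+2}^{−1}, …, u X_n, v X_n^{−1})`. -/
def tailArgs (n i : ℕ) : List (Fld n) :=
  ((List.finRange n).drop (n - (i - 1))).flatMap fun d => [uu n * XP d, vv n * (XP d)⁻¹]

/-- The `2(n−i+1)` quantities `(u X_1, v X_1^{−1}, …, u X_{n−i+1}, v X_{n−i+1}^{−1})`. -/
def headArgs (n i : ℕ) : List (Fld n) :=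
  ((List.finRange n).take (n - i + 1)).flatMap fun d => [uu n * XP d, vv n * (XP d)⁻¹]

theorem hz_of_neg {R : Type*} [CommSemiring R] {m : ℤ} (hm : m < 0) (l : List R) :
    hz m l = 0 := if_pos hm

theorem ez_of_neg {R : Type*} [CommSemiring R] {m : ℤ} (hm : m < 0) (l : List R) :
    ez m l = 0 := if_pos hm

theorem hz_cons {R : Type*} [CommSemiring R] (m : ℤ) (x : R) (l : List R) :
    hz m (x :: l) = hz m l + x * hz (m - 1) (x :: l) := by
  rcases lt_trichotomy m 0 with h | rfl | h
  · simp [hz_of_neg h, hz_of_neg (show m - 1 < 0 by omega)]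
  · simp [hz, hpow]
  · obtain ⟨k, rfl⟩ : ∃ k : ℕ, m = k + 1 := ⟨(m - 1).toNat, by omega⟩
    have h1 : ¬ ((k : ℤ) + 1 < 0) := by omega
    have h2 : ((k : ℤ) + 1).toNat = k + 1 := by omega
    simp [hz, h1, h2, hpow, (Int.natCast_nonneg k).not_gt]

theorem ez_cons {R : Type*} [CommSemiring R] (m : ℤ) (x : R) (l : List R) :
    ez m (x :: l) = ez m l + x * ez (m - 1) l := by
  rcases lt_trichotomy m 0 with h | rfl | h
  · simp [ez_of_neg h, ez_of_neg (show m - 1 < 0 by omega)]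
  · simp [ez, epow]
  · obtain ⟨k, rfl⟩ : ∃ k : ℕ, m = k + 1 := ⟨(m - 1).toNat, by omega⟩
    have h1 : ¬ ((k : ℤ) + 1 < 0) := by omega
    have h2 : ((k : ℤ) + 1).toNat = k + 1 := by omega
    simp [ez, h1, h2, epow, (Int.natCast_nonneg k).not_gt]

theorem ez_nil {R : Type*} [CommSemiring R] (m : ℤ) :
    ez m ([] : List R) = if m = 0 then 1 else 0 := by
  rcases lt_trichotomy m 0 with h | rfl | h
  · simp [ez_of_neg h, h.ne]
  · simp [ez, epow]
  · obtain ⟨k, rfl⟩ : ∃ k : ℕ, m = k + 1 := ⟨(m - 1).toNat, by omega⟩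
    have h1 : ¬ ((k : ℤ) + 1 < 0) := by omega
    have h2 : ((k : ℤ) + 1).toNat = k + 1 := by omega
    simp [ez, h1, h2, epow, h.ne']

theorem ez_eq_zero_of_length_lt {R : Type*} [CommSemiring R] (l : List R) {m : ℤ}
    (hm : (l.length : ℤ) < m) : ez m l = 0 := by
  induction l generalizing m with
  | nil =>
    rw [ez_nil, if_neg (by simpa using hm.ne')]
  | cons x l ih =>
    simp only [List.length_cons, Nat.cast_add, Nat.cast_one] at hm
    rw [ez_cons, ih (by omega), ih (by omega), mul_zero, add_zero]

/-- The recursion `hz_cons` holds for an entry at any position of the list. -/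
theorem hz_append_cons {R : Type*} [CommSemiring R] (m : ℤ) (x : R) (A B : List R) :
    hz m (A ++ x :: B) = hz m (A ++ B) + x * hz (m - 1) (A ++ x :: B) := by
  rcases lt_or_ge m 0 with h | h
  · simp [hz_of_neg h, hz_of_neg (show m - 1 < 0 by omega)]
  lift m to ℕ using h
  induction m generalizing A with
  | zero => simp [hz, hpow]
  | succ m ihm =>
    induction A with
    | nil => exact hz_cons _ _ _
    | cons a A ihA =>
      have h := ihm (a :: A)
      have e : ((m + 1 : ℕ) : ℤ) - 1 = m := by omega
      simp only [List.cons_append] at h ⊢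
      rw [hz_cons ((m + 1 : ℕ) : ℤ) a (A ++ x :: B), ihA,
        hz_cons ((m + 1 : ℕ) : ℤ) a (A ++ B), e]
      conv_lhs => rw [h]
      conv_rhs => rw [hz_cons (m : ℤ) a (A ++ x :: B)]
      ring

/-- Multiplying the generating function of the `h_m (A ++ T)` by `∏_{x ∈ T} (1 - x t)`
gives that of the `h_m A`. -/
theorem sum_ez_mul_hz_append {R : Type*} [CommRing R] (A T : List R) (N : ℤ) (K : ℕ)
    (hK : T.length ≤ K) :
    ∑ j ∈ Finset.range (K + 1), (-1 : R) ^ j * ez j T * hz (N - j) (A ++ T) = hz N A := by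
  induction T generalizing K with
  | nil =>
    rw [Finset.sum_range_succ', Finset.sum_eq_zero]
    · simp [ez_nil]
    · intro j _
      rw [ez_nil, if_neg (by omega)]
      simp
  | cons x T ih =>
    simp only [List.length_cons] at hK
    obtain ⟨K, rfl⟩ : ∃ k, K = k + 1 := ⟨K - 1, by omega⟩
    rw [← ih (K + 1) (by omega)]
    have hlast : ez ((K + 1 : ℕ) : ℤ) T = 0 := ez_eq_zero_of_length_lt T (by omega)
    have split : ∀ j : ℕ, (-1 : R) ^ j * ez j (x :: T) * hz (N - j) (A ++ x :: T) =
        (-1 : R) ^ j * ez j T * hz (N - j) (A ++ x :: T) +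
        (-1 : R) ^ j * x * ez ((j : ℤ) - 1) T * hz (N - j) (A ++ x :: T) := fun j => by
      rw [ez_cons]; ring
    have shift : ∑ j ∈ Finset.range (K + 1 + 1),
        (-1 : R) ^ j * x * ez ((j : ℤ) - 1) T * hz (N - j) (A ++ x :: T) =
        ∑ j ∈ Finset.range (K + 1 + 1),
          -((-1 : R) ^ j * ez j T * (x * hz (N - j - 1) (A ++ x :: T))) := by
      rw [Finset.sum_range_succ', Finset.sum_range_succ _ (K + 1), hlast,
        ez_of_neg (by simp : ((0 : ℕ) : ℤ) - 1 < 0)]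
      simp only [mul_zero, zero_mul, neg_zero, add_zero]
      refine Finset.sum_congr rfl fun j _ => ?_
      rw [show ((j + 1 : ℕ) : ℤ) - 1 = j by omega,
        show N - ((j + 1 : ℕ) : ℤ) = N - j - 1 by omega]
      ring
    rw [Finset.sum_congr rfl fun j _ => split j, Finset.sum_add_distrib, shift,
      ← Finset.sum_add_distrib]
    refine Finset.sum_congr rfl fun j _ => ?_
    rw [hz_append_cons (N - j) x A T]
    ring

/-- Elementary symmetric polynomials of `k` pairs with common product `q` are symmetric about
degree `k`, up to powers of `q`. -/
theorem ez_flatMap_pair_symm {R ι : Type*} [CommSemiring R] (a b : ι → R) (q : R)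
    (hq : ∀ d, a d * b d = q) (L : List ι) (p : ℕ) :
    ez ((L.length : ℤ) + p) (L.flatMap fun d => [a d, b d]) =
      q ^ p * ez ((L.length : ℤ) - p) (L.flatMap fun d => [a d, b d]) := by
  induction L generalizing p with
  | nil =>
    rcases p with _ | p
    · simp
    · simp only [List.flatMap_nil, ez_nil, List.length_nil]
      rw [if_neg (by omega), if_neg (by omega), mul_zero]
  | cons d L ih =>
    rcases p with _ | p
    · simp
    · have h0 := ih p
      have h1 := ih (p + 1)
      have h2 := ih (p + 2)
      simp only [List.flatMap_cons, List.cons_append, List.nil_append, ez_cons,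
        List.length_cons] at *
      generalize (L.flatMap fun d => [a d, b d]) = T at *
      push_cast at *
      rw [show (L.length : ℤ) + 1 + (p + 1) = L.length + (p + 2) by ring,
        show (L.length : ℤ) + (p + 2) - 1 = L.length + (p + 1) by ring,
        show (L.length : ℤ) + (p + 1) - 1 = L.length + p by ring,
        show (L.length : ℤ) + 1 - (p + 1) = L.length - p by ring,
        show (L.length : ℤ) - p - 1 = L.length - (p + 1) by ring,
        show (L.length : ℤ) - (p + 1) - 1 = L.length - (p + 2) by ring, h0, h1, h2]
      simp only [← hq d]
      ring

theorem sum_range_two_mul_add_one {M : Type*} [AddCommMonoid M] (k : ℕ) (f : ℕ → M) :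
    ∑ j ∈ Finset.range (2 * k + 1), f j =
      f k + ∑ p ∈ Finset.range k, (f (k - (p + 1)) + f (k + (p + 1))) := by
  induction k generalizing f with
  | zero => simp
  | succ k ih =>
    rw [show 2 * (k + 1) + 1 = 2 * k + 1 + 1 + 1 by ring, Finset.sum_range_succ,
      Finset.sum_range_succ', ih fun j => f (j + 1), Finset.sum_range_succ _ k, Nat.sub_self,
      show k + 1 + (k + 1) = 2 * k + 1 + 1 by ring, add_assoc, add_assoc]
    congr 2
    refine Finset.sum_congr rfl fun p hp => ?_
    have := Finset.mem_range.mp hp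
    rw [show k - (p + 1) + 1 = k + 1 - (p + 1) by omega,
      show k + (p + 1) + 1 = k + 1 + (p + 1) by omega]

theorem XP_ne_zero {n : ℕ} (d : Fin n) : XP d ≠ 0 := by
  simp [XP, MvPolynomial.X_ne_zero]

theorem headArgs_append_tailArgs {n i : ℕ} (hi1 : 1 ≤ i) (hin : i ≤ n) :
    headArgs n i ++ tailArgs n i = interArgs n := by
  rw [headArgs, tailArgs, interArgs, ← List.flatMap_append,
    show n - (i - 1) = n - i + 1 by omega, List.take_append_drop]

/-- **Lemma 6.2.** For `n ≥ 1`, an integer `m` with `m + n ≥ 0`, and `1 ≤ i ≤ n`, in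
`ℚ(u,v,w,X_1,…,X_n)`:
`Σ_{l=1}^n (−1)^{i+l} c_l e_{i−l}(uX_{n−i+2}, vX_{n−i+2}^{−1}, …, uX_n, vX_n^{−1})
   [h_{m+l−1}(uX_1, vX_1^{−1}, …, uX_n, vX_n^{−1})
     + (uv)^{l−1} h_{m−l+1}(uX_1, vX_1^{−1}, …, uX_n, vX_n^{−1})]
 = h_{m+i−1}(uX_1, vX_1^{−1}, …, uX_{n−i+1}, vX_{n−i+1}^{−1})`,
where `c_1 = 1/2` and `c_l = 1` for `l ≥ 2`. -/
theorem sum_e_mul_h_eq_h (n : ℕ) (hn : 1 ≤ n) (m : ℤ) (hm : 0 ≤ m + n)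
    (i : ℕ) (hi1 : 1 ≤ i) (hin : i ≤ n) :
    (∑ l ∈ Finset.Icc 1 n,
        (-1 : Fld n) ^ (i + l) * (if l = 1 then (1 / 2 : Fld n) else 1) *
          ez ((i : ℤ) - (l : ℤ)) (tailArgs n i) *
          (hz (m + (l : ℤ) - 1) (interArgs n) +
            (uu n * vv n) ^ (l - 1) * hz (m - (l : ℤ) + 1) (interArgs n))) =
      hz (m + (i : ℤ) - 1) (headArgs n i) := by
  obtain ⟨k, rfl⟩ : ∃ k, i = k + 1 := ⟨i - 1, by omega⟩
  have hsymm : ∀ p : ℕ, ez ((k : ℤ) + p) (tailArgs n (k + 1)) =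
      (uu n * vv n) ^ p * ez ((k : ℤ) - p) (tailArgs n (k + 1)) := fun p => by
    have h := ez_flatMap_pair_symm (fun d : Fin n => uu n * XP d) (fun d => vv n * (XP d)⁻¹)
      (uu n * vv n) (fun d => by have := XP_ne_zero d; field_simp)
      ((List.finRange n).drop (n - (k + 1 - 1))) p
    rwa [List.length_drop, List.length_finRange, show n - (n - (k + 1 - 1)) = k by omega] at h
  have hlen : (tailArgs n (k + 1)).length ≤ 2 * k := by
    simp [tailArgs, List.length_flatMap]
    omega
  rw [← sum_ez_mul_hz_append (headArgs n (k + 1)) (tailArgs n (k + 1)) _ (2 * k) hlen,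
    headArgs_append_tailArgs hi1 hin, sum_range_two_mul_add_one,
    ← Finset.sum_subset (Finset.Icc_subset_Icc_right hin), ← Finset.Ico_add_one_right_eq_Icc,
    Finset.sum_Ico_eq_sum_range, Nat.add_sub_cancel, Finset.sum_range_succ', add_comm]
  · congr 1
    · simp only [add_zero, Nat.cast_one, Nat.cast_add, if_true, Nat.sub_self, pow_zero, one_mul]
      rw [show m + 1 - 1 = m by ring, show m - 1 + 1 = m by ring,
        show m + ((k : ℤ) + 1) - 1 - k = m by ring, show (k : ℤ) + 1 - 1 = k by ring,
        add_assoc, pow_add]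
      ring
    · refine Finset.sum_congr rfl fun p hp => ?_
      have hp := Finset.mem_range.mp hp
      obtain ⟨r, rfl⟩ : ∃ r, k = r + (p + 1) := ⟨k - (p + 1), by omega⟩
      have h := hsymm (p + 1)
      rw [Nat.add_sub_cancel, if_neg (by omega), Nat.add_sub_cancel_left]
      have s1 : (-1 : Fld n) ^ (r + (p + 1) + 1 + (1 + (p + 1))) = (-1) ^ r := by
        rw [show r + (p + 1) + 1 + (1 + (p + 1)) = r + 2 * (p + 2) by ring, pow_add, pow_mul]
        simp
      have s2 : (-1 : Fld n) ^ (r + (p + 1) + (p + 1)) = (-1) ^ r := by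
        rw [show r + (p + 1) + (p + 1) = r + 2 * (p + 1) by ring, pow_add, pow_mul]
        simp
      rw [s1, s2]
      push_cast at h ⊢
      rw [h]
      ring_nf
  · intro l _ hl
    simp only [Finset.mem_Icc, not_and, not_le] at *
    rw [ez_of_neg (by push_cast; omega)]
    ring


end
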